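/- For every real ν ≥ 0, let j_{ν,1} denote the first positive zero of the Bessel function J_ν. Then for every integer k ≥ 0, (j_{k,1})² ≥ (j_{0,1})² + k². Consequently, if τ ∈ ℝ with |τ − 1/2| ≥ 0 arbitrary and ρ > 0, the smallest Dirichlet eigenvalue E_τ = (j_{|τ−1/2|,1})²/ρ² of the operator u ↦ −u'' + ((τ²−τ)/r²) u on (0, ρ) satisfies E_τ ≥ (j_{0,1})²/ρ² ≥ 4/ρ² whenever (j_{0,1})² ≥ 4. -/

import Mathlib

open Real

noncomputable section

/-- The Bessel function of the first kind of order ν ≥ 0, defined by its power series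
(for x > 0, using real powers). -/
def besselJ (ν : ℝ) (x : ℝ) : ℝ :=
  ∑' m : ℕ, ((-1 : ℝ) ^ m / (m.factorial * Real.Gamma (ν + m + 1))) * (x / 2) ^ (2 * m + ν)

/-- The first positive zero of J_ν. -/
def besselZero (ν : ℝ) : ℝ :=
  sInf {x : ℝ | 0 < x ∧ besselJ ν x = 0}

open Set Filter Topology

/-- The coefficients of the entire function `t ↦ ∑ (-1)^m t^m / (m! Γ(ν + m + 1))`. -/
def besselCoeff (ν : ℝ) (m : ℕ) : ℝ :=
  (-1 : ℝ) ^ m / (m.factorial * Real.Gamma (ν + m + 1))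

/-- The entire function `F_ν` with `J_ν(x) = (x / 2) ^ ν * F_ν(x² / 4)`. -/
def besselF (ν t : ℝ) : ℝ := ∑' m : ℕ, besselCoeff ν m * t ^ m

/-- The Bessel function in the logarithmic variable, up to a constant factor. -/
def besselG (ν κ s : ℝ) : ℝ := exp (ν * s) * besselF ν (κ * exp (2 * s) / 4)

/-- The derivative of `besselG`. -/
def besselGDeriv (ν κ s : ℝ) : ℝ :=
  exp (ν * s) * (ν * besselF ν (κ * exp (2 * s) / 4)
    - 2 * (κ * exp (2 * s) / 4) * besselF (ν + 1) (κ * exp (2 * s) / 4))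

lemma gamma_le_gamma_add_nat {ν : ℝ} (hν : 0 ≤ ν) (m : ℕ) :
    Real.Gamma (ν + 1) ≤ Real.Gamma (ν + m + 1) := by
  induction m with
  | zero => simp
  | succ m ih =>
    have hm : (0 : ℝ) ≤ m := m.cast_nonneg
    have hG : 0 < Real.Gamma (ν + m + 1) := Real.Gamma_pos_of_pos (by positivity)
    have h : Real.Gamma (ν + (m + 1 : ℕ) + 1) = (ν + m + 1) * Real.Gamma (ν + m + 1) := by
      rw [← Real.Gamma_add_one (by positivity)]
      push_cast
      ring_nf
    rw [h]
    nlinarith [mul_nonneg (add_nonneg hν hm) hG.le]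

lemma abs_besselCoeff_le {ν : ℝ} (hν : 0 ≤ ν) (m : ℕ) :
    |besselCoeff ν m| ≤ (Real.Gamma (ν + 1))⁻¹ / m.factorial := by
  have h0 : 0 < Real.Gamma (ν + 1) := Real.Gamma_pos_of_pos (by positivity)
  have h1 := gamma_le_gamma_add_nat hν m
  have h2 : (0 : ℝ) < m.factorial := by positivity
  rw [besselCoeff, abs_div, abs_pow, abs_neg, abs_one, one_pow,
    abs_of_pos (mul_pos h2 (h0.trans_le h1)), inv_eq_one_div, div_div]
  apply one_div_le_one_div_of_le (by positivity)
  rw [mul_comm]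
  gcongr

lemma summable_besselCoeff_mul_pow {ν : ℝ} (hν : 0 ≤ ν) (t : ℝ) :
    Summable fun m : ℕ => besselCoeff ν m * t ^ m := by
  refine Summable.of_norm_bounded
    ((Real.summable_pow_div_factorial |t|).mul_left (Real.Gamma (ν + 1))⁻¹) fun m => ?_
  rw [Real.norm_eq_abs, abs_mul, abs_pow]
  calc |besselCoeff ν m| * |t| ^ m ≤ (Real.Gamma (ν + 1))⁻¹ / m.factorial * |t| ^ m := by
        gcongr
        exact abs_besselCoeff_le hν m
    _ = _ := by ring

lemma succ_mul_besselCoeff_succ (ν : ℝ) (m : ℕ) :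
    ((m + 1 : ℕ) : ℝ) * besselCoeff ν (m + 1) = -besselCoeff (ν + 1) m := by
  have h : ν + ((m + 1 : ℕ) : ℝ) + 1 = ν + 1 + m + 1 := by push_cast; ring
  have h2 : ((m + 1 : ℕ) : ℝ) ≠ 0 := by positivity
  rw [besselCoeff, besselCoeff, h, Nat.factorial_succ, pow_succ, Nat.cast_mul, mul_assoc,
    mul_div_assoc', mul_div_mul_left _ _ h2]
  ring

lemma hasDerivAt_besselF {ν : ℝ} (hν : 0 ≤ ν) (t : ℝ) :
    HasDerivAt (besselF ν) (-besselF (ν + 1) t) t := by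
  have hν1 : 0 ≤ ν + 1 := by positivity
  set R : ℝ := |t| + 1 with hR
  have hR0 : 0 ≤ R := by positivity
  have hbound : Summable fun m : ℕ => |(m : ℝ) * besselCoeff ν m| * R ^ (m - 1) := by
    rw [← summable_nat_add_iff 1]
    refine (summable_besselCoeff_mul_pow hν1 R).norm.congr fun m => ?_
    rw [succ_mul_besselCoeff_succ, abs_neg, Real.norm_eq_abs, abs_mul, abs_pow, abs_of_nonneg hR0,
      Nat.add_sub_cancel]
  have key := hasDerivAt_tsum_of_isPreconnected (𝕜 := ℝ)
    (g := fun (m : ℕ) (x : ℝ) => besselCoeff ν m * x ^ m)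
    (g' := fun (m : ℕ) (x : ℝ) => besselCoeff ν m * ((m : ℝ) * x ^ (m - 1)))
    hbound (Metric.isOpen_ball (x := (0 : ℝ)) (ε := R)) (convex_ball _ _).isPreconnected
    (fun m x _ => (hasDerivAt_pow m x).const_mul _)
    (fun m x hx => ?_) (y₀ := 0) (by simp [hR]; positivity)
    (summable_besselCoeff_mul_pow hν 0) (y := t) (by simp [hR])
  · refine key.congr_deriv ?_
    rw [tsum_eq_zero_add']
    · simp only [Nat.cast_zero, zero_mul, mul_zero, zero_add, besselF, ← tsum_neg]
      refine tsum_congr fun m => ?_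
      rw [← mul_assoc, mul_comm (besselCoeff ν (m + 1)), succ_mul_besselCoeff_succ,
        Nat.add_sub_cancel, neg_mul]
    · refine (summable_besselCoeff_mul_pow hν1 t).neg.congr fun m => ?_
      rw [← mul_assoc, mul_comm (besselCoeff ν (m + 1)), succ_mul_besselCoeff_succ,
        Nat.add_sub_cancel, neg_mul]
  · have hx' : |x| ≤ R := by simpa using (Metric.mem_ball.1 hx).le
    rw [← mul_assoc, mul_comm (besselCoeff ν m), Real.norm_eq_abs, abs_mul, abs_pow]
    gcongr

lemma continuous_besselF {ν : ℝ} (hν : 0 ≤ ν) : Continuous (besselF ν) :=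
  continuous_iff_continuousAt.2 fun t => (hasDerivAt_besselF hν t).continuousAt

lemma besselF_eq {ν : ℝ} (hν : 0 ≤ ν) (t : ℝ) :
    besselF ν t = (ν + 1) * besselF (ν + 1) t - t * besselF (ν + 2) t := by
  have hν1 : 0 ≤ ν + 1 := by positivity
  have hν2 : 0 ≤ ν + 2 := by positivity
  have hc (m : ℕ) : besselCoeff ν m
      = (ν + 1) * besselCoeff (ν + 1) m + m * besselCoeff (ν + 1) m := by
    have h : ν + 1 + m ≠ 0 := by positivity
    have h3 : ν + 1 + (m : ℝ) = ν + m + 1 := by ring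
    have hG : Real.Gamma (ν + 1 + m) ≠ 0 := (Real.Gamma_pos_of_pos (by positivity)).ne'
    rw [besselCoeff, besselCoeff, Real.Gamma_add_one h, ← h3]
    field_simp
  have hS : HasSum (fun m : ℕ => (m : ℝ) * besselCoeff (ν + 1) m * t ^ m)
      (-(t * besselF (ν + 2) t)) := by
    rw [← hasSum_nat_add_iff' 1]
    have h := ((summable_besselCoeff_mul_pow hν2 t).hasSum.mul_left t).neg
    simp only [Finset.range_one, Finset.sum_singleton, Nat.cast_zero, zero_mul, sub_zero]
    refine h.congr_fun ?_
    intro m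
    rw [succ_mul_besselCoeff_succ, pow_succ, show ν + 1 + 1 = ν + 2 by ring]
    ring
  have h := ((summable_besselCoeff_mul_pow hν1 t).hasSum.mul_left (ν + 1)).add hS
  rw [sub_eq_add_neg]
  refine Eq.trans (tsum_congr fun m => ?_) h.tsum_eq
  rw [hc]
  ring

lemma besselF_zero (ν : ℝ) : besselF ν 0 = (Real.Gamma (ν + 1))⁻¹ := by
  rw [besselF, tsum_eq_single 0 (fun m hm => by simp [hm])]
  simp [besselCoeff]

lemma besselF_zero_pos {ν : ℝ} (hν : 0 ≤ ν) : 0 < besselF ν 0 := by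
  rw [besselF_zero]
  exact inv_pos.2 (Real.Gamma_pos_of_pos (by positivity))

lemma besselJ_eq (ν : ℝ) {x : ℝ} (hx : 0 < x) :
    besselJ ν x = (x / 2) ^ ν * besselF ν (x ^ 2 / 4) := by
  rw [besselJ, besselF, ← tsum_mul_left]
  refine tsum_congr fun m => ?_
  rw [besselCoeff, Real.rpow_add (by positivity), show (2 * (m : ℝ)) = ((2 * m : ℕ) : ℝ) by simp,
    Real.rpow_natCast, pow_mul, show (x / 2) ^ 2 = x ^ 2 / 4 by ring]
  ring

lemma besselJ_eq_zero_iff (ν : ℝ) {x : ℝ} (hx : 0 < x) :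
    besselJ ν x = 0 ↔ besselF ν (x ^ 2 / 4) = 0 := by
  rw [besselJ_eq ν hx, mul_eq_zero, or_iff_right (Real.rpow_pos_of_pos (by positivity) ν).ne']

lemma hasDerivAt_besselG {ν : ℝ} (hν : 0 ≤ ν) (κ s : ℝ) :
    HasDerivAt (besselG ν κ) (besselGDeriv ν κ s) s := by
  have he : HasDerivAt (fun s : ℝ => exp (ν * s)) (exp (ν * s) * ν) s := by
    simpa using ((hasDerivAt_id s).const_mul ν).exp
  have ht : HasDerivAt (fun s : ℝ => κ * exp (2 * s) / 4) (κ * (exp (2 * s) * 2) / 4) s := by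
    simpa using ((((hasDerivAt_id s).const_mul 2).exp).const_mul κ).div_const 4
  refine (he.mul ((hasDerivAt_besselF hν _).comp s ht)).congr_deriv ?_
  simp only [besselGDeriv, Function.comp]
  ring

lemma hasDerivAt_besselGDeriv {ν : ℝ} (hν : 0 ≤ ν) (κ s : ℝ) :
    HasDerivAt (besselGDeriv ν κ) ((ν ^ 2 - κ * exp (2 * s)) * besselG ν κ s) s := by
  have he : HasDerivAt (fun s : ℝ => exp (ν * s)) (exp (ν * s) * ν) s := by
    simpa using ((hasDerivAt_id s).const_mul ν).exp
  have ht : HasDerivAt (fun s : ℝ => κ * exp (2 * s) / 4) (κ * (exp (2 * s) * 2) / 4) s := by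
    simpa using ((((hasDerivAt_id s).const_mul 2).exp).const_mul κ).div_const 4
  have h0 := (hasDerivAt_besselF hν _).comp s ht
  have h1 := (hasDerivAt_besselF (ν := ν + 1) (by positivity) _).comp s ht
  refine (he.mul ((h0.const_mul ν).sub ((ht.const_mul 2).mul h1))).congr_deriv ?_
  simp only [besselG, Function.comp, besselF_eq hν (κ * exp (2 * s) / 4),
    show ν + 1 + 1 = ν + 2 by ring, Pi.sub_apply, Pi.mul_apply]
  ring

/-- Sturm comparison with the sine function: `J_ν` has a positive zero. -/
lemma exists_besselJ_eq_zero {ν : ℝ} (hν : 0 ≤ ν) : ∃ x, 0 < x ∧ besselJ ν x = 0 := by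
  by_contra! hne
  have hF (s : ℝ) : besselF ν (exp s / 4) ≠ 0 := by
    have h := hne (exp (s / 2)) (exp_pos _)
    rw [Ne, besselJ_eq_zero_iff ν (exp_pos _), ← Real.exp_nat_mul] at h
    convert h using 4
    push_cast
    ring
  have hpos (t : ℝ) (ht : 0 ≤ t) : 0 < besselF ν t := by
    by_contra! hle
    obtain ⟨r, hr, hr0⟩ := intermediate_value_Icc' ht (continuous_besselF hν).continuousOn
      ⟨hle, (besselF_zero_pos hν).le⟩
    have hr' : 0 < r := hr.1.lt_of_ne fun h => (besselF_zero_pos hν).ne' (h ▸ hr0)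
    apply hF (log (4 * r))
    rwa [exp_log (by positivity), mul_div_cancel_left₀ _ four_ne_zero]
  have hG (s : ℝ) : 0 < besselG ν 1 s := mul_pos (exp_pos _) (hpos _ (by positivity))
  set A : ℝ := ν ^ 2 + 1
  set W : ℝ → ℝ := fun s => besselGDeriv ν 1 s * sin (s - A) - besselG ν 1 s * cos (s - A)
  have hW (s : ℝ) : HasDerivAt W ((ν ^ 2 + 1 - exp (2 * s)) * besselG ν 1 s * sin (s - A)) s := by
    have hs : HasDerivAt (fun s => sin (s - A)) (cos (s - A)) s := by
      simpa using ((hasDerivAt_id s).sub_const A).sin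
    have hc : HasDerivAt (fun s => cos (s - A)) (-sin (s - A)) s := by
      simpa using ((hasDerivAt_id s).sub_const A).cos
    refine (((hasDerivAt_besselGDeriv hν 1 s).mul hs).sub
      ((hasDerivAt_besselG hν 1 s).mul hc)).congr_deriv ?_
    ring
  have hanti : AntitoneOn W (Icc A (A + π)) := by
    refine antitoneOn_of_deriv_nonpos (convex_Icc _ _)
      (fun s _ => (hW s).continuousAt.continuousWithinAt)
      (fun s _ => (hW s).differentiableAt.differentiableWithinAt) fun s hs => ?_
    rw [interior_Icc] at hs
    rw [(hW s).deriv]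
    have h1 : ν ^ 2 + 1 - exp (2 * s) ≤ 0 := by
      have := Real.add_one_le_exp (2 * s)
      have hA : A = ν ^ 2 + 1 := rfl
      nlinarith [hs.1, sq_nonneg ν]
    exact mul_nonpos_of_nonpos_of_nonneg (mul_nonpos_of_nonpos_of_nonneg h1 (hG s).le)
      (sin_nonneg_of_nonneg_of_le_pi (by linarith [hs.1]) (by linarith [hs.2]))
  have hle := hanti (left_mem_Icc.2 (by linarith [pi_pos])) (right_mem_Icc.2 (by linarith [pi_pos]))
    (by linarith [pi_pos])
  simp only [W, add_sub_cancel_left, sub_self, sin_pi, cos_pi, sin_zero, cos_zero] at hle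
  linarith [hG A, hG (A + π)]

/-- Picone comparison: if `F_0` is positive on `[0, c² / 4]`, every positive zero `b` of `J_ν`
satisfies `c² + ν² ≤ b²`. -/
lemma sq_add_sq_le_sq_of_besselF_pos {ν b c : ℝ} (hν : 0 ≤ ν) (hb : 0 < b)
    (hzero : besselJ ν b = 0) (hpos : ∀ t ∈ Icc 0 (c ^ 2 / 4), 0 < besselF 0 t) :
    c ^ 2 + ν ^ 2 ≤ b ^ 2 := by
  by_contra! hlt
  set κ : ℝ := c ^ 2 / b ^ 2 with hκ
  have hκb : κ * b ^ 2 = c ^ 2 := div_mul_cancel₀ _ (by positivity)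
  have hκ0 : 0 ≤ κ := by positivity
  set B : ℝ := log b
  have hexpB : exp (2 * B) = b ^ 2 := by
    rw [two_mul, exp_add, exp_log hb, sq]
  have hexp {s : ℝ} (hs : s ≤ B) : exp (2 * s) ≤ b ^ 2 := by
    rw [← hexpB]
    gcongr
  have hw {s : ℝ} (hs : s ≤ B) : 0 < besselG 0 κ s := by
    refine mul_pos (exp_pos _) (hpos _ ⟨by positivity, ?_⟩)
    rw [← hκb]
    gcongr
    exact hexp hs
  have huB : besselG ν 1 B = 0 := by
    rw [besselG, hexpB, one_mul, (besselJ_eq_zero_iff ν hb).1 hzero, mul_zero]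
  set u : ℝ → ℝ := besselG ν 1
  set u' : ℝ → ℝ := besselGDeriv ν 1
  set w : ℝ → ℝ := besselG 0 κ
  set w' : ℝ → ℝ := besselGDeriv 0 κ
  set P : ℝ → ℝ := fun s => u s * u' s - u s ^ 2 * (w' s / w s) with hPdef
  set P' : ℝ → ℝ := fun s =>
    (u' s - u s * (w' s / w s)) ^ 2 + u s ^ 2 * (ν ^ 2 - exp (2 * s) + κ * exp (2 * s))
  have hP {s : ℝ} (hs : s ≤ B) : HasDerivAt P (P' s) s := by
    have hu : HasDerivAt u (u' s) s := hasDerivAt_besselG hν 1 s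
    have hu' : HasDerivAt u' ((ν ^ 2 - 1 * exp (2 * s)) * u s) s :=
      hasDerivAt_besselGDeriv hν 1 s
    have hw₁ : HasDerivAt w (w' s) s := hasDerivAt_besselG le_rfl κ s
    have hw₁' : HasDerivAt w' ((0 ^ 2 - κ * exp (2 * s)) * w s) s :=
      hasDerivAt_besselGDeriv le_rfl κ s
    have hne : w s ≠ 0 := (hw hs).ne'
    refine ((hu.mul hu').sub ((hu.pow 2).mul (hw₁'.div hw₁ hne))).congr_deriv ?_
    simp only [P', Pi.pow_apply, Pi.div_apply]
    field_simp
    ring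
  have hq {s : ℝ} (hs : s ≤ B) : 0 < ν ^ 2 - exp (2 * s) + κ * exp (2 * s) := by
    have h1 := hexp hs
    have h2 := exp_pos (2 * s)
    rcases le_total κ 1 with h | h
    · nlinarith [mul_nonneg (sub_nonneg.2 h) (sub_nonneg.2 h1)]
    · rcases h.eq_or_lt with h | h
      · nlinarith
      · nlinarith [mul_pos (sub_pos.2 h) h2, sq_nonneg ν]
  have hP'0 {s : ℝ} (hs : s ≤ B) : 0 ≤ P' s :=
    add_nonneg (sq_nonneg _) (mul_nonneg (sq_nonneg _) (hq hs).le)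
  have hmono : MonotoneOn P (Iic B) := by
    refine monotoneOn_of_deriv_nonneg (convex_Iic _)
      (fun s hs => (hP hs).continuousAt.continuousWithinAt)
      (fun s hs => (hP (mem_Iic.1 (interior_subset hs))).differentiableAt.differentiableWithinAt)
      fun s hs => ?_
    have hs' : s ≤ B := mem_Iic.1 (interior_subset hs)
    rw [(hP hs').deriv]
    exact hP'0 hs'
  have htend (a : ℝ) : Tendsto (fun s : ℝ => a * exp (2 * s) / 4) atBot (𝓝 0) := by
    have h : Tendsto (fun s : ℝ => exp (2 * s)) atBot (𝓝 0) :=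
      tendsto_exp_atBot.comp (tendsto_id.const_mul_atBot two_pos)
    simpa using (h.const_mul a).div_const 4
  have hF (a : ℝ) {μ : ℝ} (hμ : 0 ≤ μ) :
      Tendsto (fun s : ℝ => besselF μ (a * exp (2 * s) / 4)) atBot (𝓝 (besselF μ 0)) :=
    ((continuous_besselF hμ).tendsto 0).comp (htend a)
  have hu'lim (a : ℝ) {μ : ℝ} (hμ : 0 ≤ μ) : Tendsto (fun s : ℝ =>
      μ * besselF μ (a * exp (2 * s) / 4)
        - 2 * (a * exp (2 * s) / 4) * besselF (μ + 1) (a * exp (2 * s) / 4)) atBot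
      (𝓝 (μ * besselF μ 0)) := by
    simpa using ((hF a hμ).const_mul μ).sub
      (((htend a).const_mul 2).mul (hF a (μ := μ + 1) (by positivity)))
  have hw'lim : Tendsto (fun s => w' s / w s) atBot (𝓝 0) := by
    have h1 : Tendsto w' atBot (𝓝 0) := by
      have h := hu'lim κ (μ := 0) le_rfl
      rw [zero_mul] at h
      exact h.congr fun s => by simp [w', besselGDeriv]
    have h2 : Tendsto w atBot (𝓝 (besselF 0 0)) := by
      exact (hF κ (μ := 0) le_rfl).congr fun s => by simp [w, besselG]
    have h := h1.div h2 (besselF_zero_pos le_rfl).ne'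
    rwa [zero_div] at h
  have hPlim : Tendsto P atBot (𝓝 0) := by
    have h := ((hF 1 hν).mul (hu'lim 1 hν)).sub (((hF 1 hν).pow 2).mul hw'lim)
    have hE : ∀ s, P s = exp (ν * s) ^ 2 * (besselF ν (1 * exp (2 * s) / 4) *
        (ν * besselF ν (1 * exp (2 * s) / 4)
        - 2 * (1 * exp (2 * s) / 4) * besselF (ν + 1) (1 * exp (2 * s) / 4))
        - besselF ν (1 * exp (2 * s) / 4) ^ 2 * (w' s / w s)) := by
      intro s
      simp only [hPdef, u, u', besselG, besselGDeriv]
      ring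
    rw [funext hE]
    rcases hν.eq_or_lt with h0 | h0
    · subst h0
      simpa using h
    · have he : Tendsto (fun s : ℝ => exp (ν * s)) atBot (𝓝 0) :=
        tendsto_exp_atBot.comp (tendsto_id.const_mul_atBot h0)
      simpa using (he.pow 2).mul h
  have hPB : P B = 0 := by simp [hPdef, huB]
  have hP0 {s : ℝ} (hs : s ≤ B) : P s = 0 := by
    refine le_antisymm (hPB ▸ hmono hs self_mem_Iic hs) (le_of_tendsto hPlim ?_)
    filter_upwards [eventually_le_atBot s] with r hr
    exact hmono (hr.trans hs) hs hr
  have hu0 {s : ℝ} (hs : s < B) : u s = 0 := by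
    have hev : P =ᶠ[𝓝 s] fun _ => 0 := by
      filter_upwards [Iio_mem_nhds hs] with r hr
      exact hP0 hr.le
    have hP's : P' s = 0 := (hP hs.le).unique ((hasDerivAt_const s 0).congr_of_eventuallyEq hev)
    by_contra hne
    exact (add_pos_of_nonneg_of_pos (sq_nonneg _)
      (mul_pos (sq_pos_of_ne_zero hne) (hq hs.le))).ne' hP's
  have hF0 : besselF ν 0 = 0 := by
    refine tendsto_nhds_unique (hF 1 hν) (tendsto_const_nhds.congr' ?_)
    filter_upwards [eventually_lt_atBot B] with s hs
    exact ((mul_eq_zero.1 (hu0 hs)).resolve_left (exp_pos _).ne').symm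
  exact (besselF_zero_pos hν).ne' hF0

lemma besselF_pos_of_lt_besselZero {c : ℝ} (hc : 0 ≤ c) (hlt : c < besselZero 0) :
    ∀ t ∈ Icc 0 (c ^ 2 / 4), 0 < besselF 0 t := by
  intro t ht
  by_contra! hle
  obtain ⟨r, hr, hr0⟩ := intermediate_value_Icc' ht.1 (continuous_besselF le_rfl).continuousOn
    ⟨hle, (besselF_zero_pos le_rfl).le⟩
  have hr' : 0 < r := hr.1.lt_of_ne fun h => (besselF_zero_pos le_rfl).ne' (h ▸ hr0)
  have hx : 0 < 2 * √r := by positivity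
  have hmem : 2 * √r ∈ {x : ℝ | 0 < x ∧ besselJ 0 x = 0} := by
    refine ⟨hx, (besselJ_eq_zero_iff 0 hx).2 ?_⟩
    rwa [mul_pow, sq_sqrt hr'.le, show (2 : ℝ) ^ 2 * r / 4 = r by ring]
  have h1 : besselZero 0 ≤ 2 * √r := csInf_le ⟨0, fun x hx => hx.1.le⟩ hmem
  have h2 : (2 * √r) ^ 2 ≤ c ^ 2 := by
    rw [mul_pow, sq_sqrt hr'.le]
    linarith [hr.2, ht.2]
  linarith [(pow_le_pow_iff_left₀ hx.le hc two_ne_zero).1 h2]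

/-- The first zeros satisfy `j_{ν,1}² ≥ j_{0,1}² + ν²` for every real `ν ≥ 0`. -/
lemma besselZero_zero_sq_add_sq_le {ν : ℝ} (hν : 0 ≤ ν) :
    besselZero 0 ^ 2 + ν ^ 2 ≤ besselZero ν ^ 2 := by
  have h0 : 0 ≤ besselZero 0 := Real.sInf_nonneg fun x hx => hx.1.le
  have hle {b : ℝ} (hb : 0 < b) (hz : besselJ ν b = 0) :
      besselZero 0 ^ 2 + ν ^ 2 ≤ b ^ 2 := by
    rcases h0.eq_or_lt with h | h
    · rw [← h]
      refine sq_add_sq_le_sq_of_besselF_pos hν hb hz fun t ht => ?_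
      have : t = 0 := le_antisymm (by simpa using ht.2) ht.1
      exact this ▸ besselF_zero_pos le_rfl
    · have hlim : Tendsto (fun c : ℝ => c ^ 2 + ν ^ 2) (𝓝[<] besselZero 0)
          (𝓝 (besselZero 0 ^ 2 + ν ^ 2)) :=
        ((continuous_pow 2).add continuous_const).continuousWithinAt
      refine le_of_tendsto hlim ?_
      filter_upwards [Ioo_mem_nhdsLT h] with c hc
      exact sq_add_sq_le_sq_of_besselF_pos hν hb hz (besselF_pos_of_lt_besselZero hc.1.le hc.2)
  have hsqrt : √(besselZero 0 ^ 2 + ν ^ 2) ≤ besselZero ν :=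
    le_csInf (exists_besselJ_eq_zero hν) fun b hb => Real.sqrt_le_iff.2 ⟨hb.1.le, hle hb.1 hb.2⟩
  exact (Real.sqrt_le_iff.1 hsqrt).2

/-- (j_{k,1})² ≥ (j_{0,1})² + k² for all integers k ≥ 0; consequently the smallest Dirichlet
eigenvalue E_τ = (j_{|τ−1/2|,1})²/ρ² of −∂² + (τ²−τ)/r² on (0,ρ) satisfies
E_τ ≥ (j_{0,1})²/ρ² ≥ 4/ρ² whenever (j_{0,1})² ≥ 4. -/
theorem besselZero_sq_lower_bound :
    (∀ k : ℕ, (besselZero k) ^ 2 ≥ (besselZero 0) ^ 2 + (k : ℝ) ^ 2) ∧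
    (∀ τ ρ : ℝ, 0 < ρ → (besselZero 0) ^ 2 ≥ 4 →
      (besselZero |τ - 1/2|) ^ 2 / ρ ^ 2 ≥ (besselZero 0) ^ 2 / ρ ^ 2 ∧
      (besselZero 0) ^ 2 / ρ ^ 2 ≥ 4 / ρ ^ 2) := by
  refine ⟨fun k => besselZero_zero_sq_add_sq_le k.cast_nonneg, fun τ ρ _ h4 => ⟨?_, ?_⟩⟩
  · have h := besselZero_zero_sq_add_sq_le (abs_nonneg (τ - 1 / 2))
    gcongr ?_ / _
    linarith [sq_nonneg |τ - 1 / 2|]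
  · gcongr

end
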